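/- For every number of agents n ≥ 1 and every finite set M of m indivisible goods, if each agent i has a monotone subadditive valuation v_i : 2^M → ℝ (v_i(∅) = 0, v_i(S) ≤ v_i(T) whenever S ⊆ T, and v_i(S ∪ T) ≤ v_i(S) + v_i(T) for all S, T ⊆ M), then there exists a complete allocation A = (A_1,…,A_n) that is 1/2-EFX: for all agents i, j and every good g ∈ A_j, v_i(A_i) ≥ (1/2)·v_i(A_j \ {g}). -/

import Mathlib

open Function in
/-- A self-map of a nonempty finite type has a periodic point. -/
theorem periodicPts_nonempty_of_finite {α : Type*} [Finite α] [Nonempty α] (f : α → α) :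
    (periodicPts f).Nonempty := by
  obtain ⟨x⟩ := ‹Nonempty α›
  obtain ⟨a, b, hab, h⟩ := Finite.exists_ne_map_eq_of_infinite (fun k : ℕ => f^[k] x)
  wlog hlt : a < b generalizing a b
  · exact this b a hab.symm h.symm (by omega)
  refine ⟨f^[a] x, mk_mem_periodicPts (n := b - a) (by omega) ?_⟩
  rw [IsPeriodicPt, IsFixedPt, ← iterate_add_apply, Nat.sub_add_cancel hlt.le]
  exact h.symm

open Function in
/-- A self-map of a nonempty finite type agrees with a permutation on a nonempty set of points,
the permutation fixing all other points. -/
theorem exists_perm_eq_or_fixed {α : Type*} [Finite α] [Nonempty α] (f : α → α) :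
    ∃ e : Equiv.Perm α, (∀ x, e x = f x ∨ e x = x) ∧ ∃ x, e x = f x := by
  classical
  let F : α → α := fun x => if x ∈ periodicPts f then f x else x
  have hbij := bijOn_periodicPts f
  have hF : Injective F := by
    intro x y hxy
    by_cases hx : x ∈ periodicPts f <;> by_cases hy : y ∈ periodicPts f <;>
      simp only [F, hx, hy, if_true, if_false] at hxy
    · exact hbij.injOn hx hy hxy
    · exact absurd (hxy ▸ hbij.mapsTo hx) hy
    · exact absurd (hxy ▸ hbij.mapsTo hy) hx
    · exact hxy
  refine ⟨Equiv.ofBijective F (Finite.injective_iff_bijective.mp hF), fun x => ?_, ?_⟩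
  · by_cases hx : x ∈ periodicPts f <;> simp [F, hx]
  · obtain ⟨x, hx⟩ := periodicPts_nonempty_of_finite f
    exact ⟨x, by simp [F, hx]⟩

section PartialAllocation

variable {ι γ : Type*} [DecidableEq γ]

/-- A family of pairwise disjoint bundles, not necessarily covering all goods, that is
`1/2`-EFX. -/
def IsHalfEFXPartial (v : ι → Finset γ → ℝ) (A : ι → Finset γ) : Prop :=
  (∀ i j, i ≠ j → Disjoint (A i) (A j)) ∧
    ∀ i j, ∀ g ∈ A j, v i (A i) ≥ (1 / 2) * v i (A j \ {g})

variable {v : ι → Finset γ → ℝ} {A : ι → Finset γ}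

/-- Reassigning the bundles so that nobody is worse off preserves `1/2`-EFX. -/
theorem IsHalfEFXPartial.comp_perm (hA : IsHalfEFXPartial v A) (e : Equiv.Perm ι)
    (h : ∀ i, v i (A i) ≤ v i (A (e i))) : IsHalfEFXPartial v (A ∘ e) :=
  ⟨fun _ _ hij => hA.1 _ _ (e.injective.ne hij),
    fun i j g hg => (hA.2 i (e j) g hg).trans (h i)⟩

variable [DecidableEq ι]

/-- An agent may exchange their bundle for a single unallocated good they value more. -/
theorem IsHalfEFXPartial.update_singleton (hv0 : ∀ i, v i ∅ = 0)
    (hmono : ∀ i (S T : Finset γ), S ⊆ T → v i S ≤ v i T)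
    (hA : IsHalfEFXPartial v A) {g : γ} (hg : ∀ i, g ∉ A i) {i : ι}
    (hi : v i (A i) ≤ v i {g}) : IsHalfEFXPartial v (Function.update A i {g}) := by
  have hnonneg : ∀ i S, 0 ≤ v i S := fun i S => hv0 i ▸ hmono i _ _ S.empty_subset
  refine ⟨fun a b hab => ?_, fun a b h hh => ?_⟩
  · rcases eq_or_ne a i with rfl | ha
    · simp [Function.update_of_ne hab.symm, hg]
    · rcases eq_or_ne b i with rfl | hb
      · simp [Function.update_of_ne hab, hg]
      · simpa [Function.update_of_ne ha, Function.update_of_ne hb] using hA.1 a b hab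
  · rcases eq_or_ne b i with rfl | hb
    · obtain rfl : h = g := by simpa using hh
      simpa [hv0] using hnonneg a _
    · rw [Function.update_of_ne hb] at hh ⊢
      have := hA.2 a b h hh
      rcases eq_or_ne a i with rfl | ha
      · rw [Function.update_self]
        linarith
      · rwa [Function.update_of_ne ha]

/-- Giving an unallocated good `g` to an unenvied agent preserves `1/2`-EFX, unless some agent
prefers `g` to their own bundle. -/
theorem IsHalfEFXPartial.update_insert (hv0 : ∀ i, v i ∅ = 0)
    (hmono : ∀ i (S T : Finset γ), S ⊆ T → v i S ≤ v i T)
    (hsub : ∀ i (S T : Finset γ), v i (S ∪ T) ≤ v i S + v i T)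
    (hA : IsHalfEFXPartial v A) {g : γ} (hg : ∀ i, g ∉ A i)
    (hle : ∀ i, v i {g} ≤ v i (A i)) {j : ι} (hj : ∀ i, v i (A j) ≤ v i (A i)) :
    IsHalfEFXPartial v (Function.update A j (insert g (A j))) := by
  have hnonneg : ∀ i S, 0 ≤ v i S := fun i S => hv0 i ▸ hmono i _ _ S.empty_subset
  refine ⟨fun a b hab => ?_, fun a b h hh => ?_⟩
  · rcases eq_or_ne a j with rfl | ha
    · simpa [Function.update_of_ne hab.symm, hg] using hA.1 a b hab
    · rcases eq_or_ne b j with rfl | hb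
      · simpa [Function.update_of_ne hab, hg] using hA.1 a b hab
      · simpa [Function.update_of_ne ha, Function.update_of_ne hb] using hA.1 a b hab
  · have hown : v a (A a) ≤ v a (Function.update A j (insert g (A j)) a) := by
      rcases eq_or_ne a j with rfl | ha
      · rw [Function.update_self]
        exact hmono _ _ _ (Finset.subset_insert _ _)
      · rw [Function.update_of_ne ha]
    rcases eq_or_ne b j with rfl | hb
    · rw [Function.update_self]
      have h1 := hmono a _ _ (Finset.sdiff_subset (s := insert g (A b)) (t := {h}))
      have h2 := hsub a {g} (A b)
      rw [← Finset.insert_eq] at h2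
      linarith [hle a, hj a]
    · rw [Function.update_of_ne hb] at hh ⊢
      exact (hA.2 a b h hh).trans hown

end PartialAllocation


/-- For every number of agents `n ≥ 1` and every finite set of `m` indivisible
goods, if each agent has a monotone subadditive valuation, then there exists a complete
allocation that is 1/2-EFX. -/
theorem half_efx_exists_subadditive (n m : ℕ) (hn : 1 ≤ n)
    (v : Fin n → Finset (Fin m) → ℝ)
    (hv0 : ∀ i, v i ∅ = 0)
    (hmono : ∀ i (S T : Finset (Fin m)), S ⊆ T → v i S ≤ v i T)
    (hsub : ∀ i (S T : Finset (Fin m)), v i (S ∪ T) ≤ v i S + v i T) :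
    ∃ A : Fin n → Finset (Fin m),
      (∀ i j, i ≠ j → Disjoint (A i) (A j)) ∧
      Finset.univ.biUnion A = Finset.univ ∧
      ∀ i j, ∀ g ∈ A j, v i (A i) ≥ (1 / 2) * v i (A j \ {g}) := by
  classical
  have : Nonempty (Fin n) := ⟨⟨0, hn⟩⟩
  let pot : (Fin n → Finset (Fin m)) → ℝ ×ₗ ℕ := fun A =>
    toLex (∑ i, v i (A i), ∑ i, (A i).card)
  have hne : (Finset.univ.filter (IsHalfEFXPartial v)).Nonempty :=
    ⟨fun _ => ∅, by simp [IsHalfEFXPartial]⟩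
  obtain ⟨A, hA, hmax⟩ := Finset.exists_max_image _ pot hne
  replace hA : IsHalfEFXPartial v A := by simpa using hA
  replace hmax : ∀ B, IsHalfEFXPartial v B → ¬ pot A < pot B :=
    fun B hB => not_lt.mpr (hmax B (by simpa using hB))
  refine ⟨A, hA.1, ?_, hA.2⟩
  by_contra hcover
  obtain ⟨g, hg⟩ : ∃ g, ∀ i, g ∉ A i := by
    simpa [Finset.eq_univ_iff_forall] using hcover
  have hle : ∀ i, v i {g} ≤ v i (A i) := by
    by_contra! ⟨i, hi⟩
    refine hmax _ (hA.update_singleton hv0 hmono hg hi.le)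
      (Prod.Lex.toLex_lt_toLex.mpr (Or.inl (Finset.sum_lt_sum (fun k _ => ?_)
        ⟨i, Finset.mem_univ i, by simpa using hi⟩)))
    rcases eq_or_ne k i with rfl | hk
    · simpa using hi.le
    · rw [Function.update_of_ne hk]
  obtain ⟨j, hj⟩ : ∃ j, ∀ i, v i (A j) ≤ v i (A i) := by
    by_contra! henvy
    choose f hf using henvy
    obtain ⟨e, he, x, hx⟩ := exists_perm_eq_or_fixed f
    have hweak : ∀ i, v i (A i) ≤ v i (A (e.symm i)) := by
      intro i
      obtain ⟨k, rfl⟩ := e.surjective i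
      rw [Equiv.symm_apply_apply]
      rcases he k with h | h
      · rw [h]
        exact (hf k).le
      · rw [h]
    refine hmax _ (hA.comp_perm e.symm hweak)
      (Prod.Lex.toLex_lt_toLex.mpr (Or.inl (Finset.sum_lt_sum (fun k _ => hweak k)
        ⟨e x, Finset.mem_univ _, ?_⟩)))
    rw [Equiv.symm_apply_apply, hx]
    exact hf x
  have hsubset : ∀ k, A k ⊆ Function.update A j (insert g (A j)) k := by
    intro k
    rcases eq_or_ne k j with rfl | hk
    · simp
    · rw [Function.update_of_ne hk]
  refine hmax _ (hA.update_insert hv0 hmono hsub hg hle hj) ?_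
  have hcard : ∑ i, (A i).card < ∑ i, (Function.update A j (insert g (A j)) i).card :=
    Finset.sum_lt_sum (fun k _ => Finset.card_le_card (hsubset k))
      ⟨j, Finset.mem_univ j, by simp [hg j]⟩
  rcases (Finset.sum_le_sum fun k (_ : k ∈ Finset.univ) =>
    hmono k _ _ (hsubset k)).lt_or_eq with h | h
  · exact Prod.Lex.toLex_lt_toLex.mpr (Or.inl h)
  · exact Prod.Lex.toLex_lt_toLex.mpr (Or.inr ⟨h, hcard⟩)
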